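/- arXiv:0709.2156 — 5 statements merged into one kernel-verified Lean document; each statement's English description precedes it below -/
import Mathlib

section
/- For every n > 2 and every initial configuration c : ZMod n → ℕ whose total number of candies satisfies ∑ i, c i ≥ 3*n - 2, the candy-passing game eventually becomes fixed: there exists a natural number T such that step (step^[T] c) = step^[T] c. -/
def step {n : ℕ} (c : ZMod n → ℕ) : ZMod n → ℕ :=
  fun i =>
    (if 2 ≤ c i then c i - 2 else c i) +
    (if 2 ≤ c (i - 1) then 1 else 0) +
    (if 2 ≤ c (i + 1) then 1 else 0)

theorem sum_step {n : ℕ} [NeZero n] (c : ZMod n → ℕ) : ∑ i, step c i = ∑ i, c i := by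
  have hl : ∑ i : ZMod n, (if 2 ≤ c (i - 1) then 1 else 0) = ∑ i, if 2 ≤ c i then 1 else 0 :=
    Equiv.sum_comp (Equiv.subRight (1 : ZMod n)) fun i => if 2 ≤ c i then 1 else 0
  have hr : ∑ i : ZMod n, (if 2 ≤ c (i + 1) then 1 else 0) = ∑ i, if 2 ≤ c i then 1 else 0 :=
    Equiv.sum_comp (Equiv.addRight (1 : ZMod n)) fun i => if 2 ≤ c i then 1 else 0
  simp only [step, Finset.sum_add_distrib]
  rw [hl, hr, ← Finset.sum_add_distrib, ← Finset.sum_add_distrib]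
  refine Finset.sum_congr rfl fun i _ => ?_
  split_ifs <;> omega

theorem sum_iterate_step {n : ℕ} [NeZero n] (c : ZMod n → ℕ) (t : ℕ) :
    ∑ i, step^[t] c i = ∑ i, c i := by
  induction t with
  | zero => rfl
  | succ t ih => rw [Function.iterate_succ_apply', sum_step, ih]

theorem step_apply_le {n : ℕ} {c : ZMod n → ℕ} {i : ZMod n} (h : 2 ≤ c i) : step c i ≤ c i := by
  simp only [step]
  split_ifs <;> omega

theorem step_apply_le_three {n : ℕ} {c : ZMod n → ℕ} {i : ZMod n} (h : c i ≤ 3) :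
    step c i ≤ 3 := by
  simp only [step]
  split_ifs <;> omega

theorem step_eq_self {n : ℕ} {c : ZMod n → ℕ} (h : ∀ i, 2 ≤ c i) : step c = c := by
  funext i
  have := h i
  simp only [step, h, if_true]
  omega

theorem iterate_step_le_three {n : ℕ} {c : ZMod n → ℕ} {i : ZMod n} {s t : ℕ} (hst : s ≤ t)
    (h : step^[s] c i ≤ 3) : step^[t] c i ≤ 3 := by
  induction t, hst using Nat.le_induction with
  | base => exact h
  | succ t _ ih =>
    rw [Function.iterate_succ_apply']
    exact step_apply_le_three ih

/-- If a student passes candy in every round from some point on, so does the next student: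
the holdings of the former are then nonincreasing, hence eventually constant. -/
theorem eventually_two_le_succ {n : ℕ} {c : ZMod n → ℕ} {i : ZMod n}
    (h : ∃ T, ∀ t ≥ T, 2 ≤ step^[t] c i) : ∃ T, ∀ t ≥ T, 2 ≤ step^[t] c (i + 1) := by
  obtain ⟨T, hT⟩ := h
  have hanti : Antitone fun t => step^[T + t] c i := by
    refine antitone_nat_of_succ_le fun t => ?_
    rw [← add_assoc, Function.iterate_succ_apply']
    exact step_apply_le (hT _ (Nat.le_add_right T t))
  obtain ⟨N, hN⟩ : ∃ N, ∀ t, step^[T + N] c i ≤ step^[T + t] c i :=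
    ⟨_, fun t => Function.argmin_le (fun t => step^[T + t] c i) t⟩
  refine ⟨T + N, fun t ht => ?_⟩
  obtain ⟨k, rfl⟩ := Nat.exists_eq_add_of_le ht
  have h₁ := hN (N + k + 1)
  have h₂ := hanti (Nat.le_add_right N k)
  have h₃ := hT (T + N + k) (by omega)
  simp only [← add_assoc] at h₁ h₂
  rw [Function.iterate_succ_apply'] at h₁
  generalize step^[T + N + k] c = d at *
  by_contra hd
  simp only [step, h₃, hd, if_true, if_false] at h₁
  split_ifs at h₁ <;> omega

theorem exists_fixed_of_eventually_two_le {n : ℕ} [NeZero n] {c : ZMod n → ℕ} {i : ZMod n}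
    (h : ∃ T, ∀ t ≥ T, 2 ≤ step^[t] c i) : ∃ T, step (step^[T] c) = step^[T] c := by
  have hk (k : ℕ) : ∃ T, ∀ t ≥ T, 2 ≤ step^[t] c (i + k) := by
    induction k with
    | zero => simpa using h
    | succ k ih =>
      rw [Nat.cast_succ, ← add_assoc]
      exact eventually_two_le_succ ih
  have hall (j : ZMod n) : ∃ T, ∀ t ≥ T, 2 ≤ step^[t] c j := by
    simpa using hk (j - i).val
  choose T hT using hall
  exact ⟨Finset.univ.sup T, step_eq_self fun j => hT j _ (Finset.le_sup (Finset.mem_univ j))⟩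

theorem step_step_step_eq {n : ℕ} [NeZero n] (hn : 2 < n) {c : ZMod n → ℕ}
    (hc : 3 * n - 2 ≤ ∑ i, c i) (h : ∀ i, c i ≤ 3) : step (step c) = step c := by
  by_cases hall : ∀ i, 2 ≤ c i
  · rw [step_eq_self hall, step_eq_self hall]
  push Not at hall
  obtain ⟨j, hj⟩ := hall
  have htwo : (2 : ZMod n) ≠ 0 := by
    intro h0
    have := (ZMod.natCast_eq_zero_iff 2 n).1 (by exact_mod_cast h0)
    exact absurd (Nat.le_of_dvd two_pos this) (by omega)
  have hone : (1 : ZMod n) ≠ 0 := by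
    intro h0
    exact htwo (by rw [← one_add_one_eq_two, h0, add_zero])
  have hdef : ∑ i, (3 - c i) ≤ 2 := by
    have : ∑ i, (3 - c i) + ∑ i, c i = 3 * n := by
      rw [← Finset.sum_add_distrib, Finset.sum_congr rfl fun i _ => Nat.sub_add_cancel (h i)]
      simp [ZMod.card, mul_comm]
    omega
  have hj1 : c j = 1 := by
    have := Finset.single_le_sum (f := fun i => 3 - c i) (fun _ _ => Nat.zero_le _)
      (Finset.mem_univ j)
    omega
  have hne (i : ZMod n) (hi : i ≠ j) : c i = 3 := by
    have := Finset.sum_le_sum_of_subset (f := fun i => 3 - c i) (Finset.subset_univ {i, j})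
    rw [Finset.sum_pair hi] at this
    have := h i
    omega
  refine step_eq_self fun i => ?_
  by_cases hi : i = j
  · subst hi
    have h₁ := hne (i - 1) (by simpa using hone)
    have h₂ := hne (i + 1) (by simpa using hone)
    simp [step, h₁, h₂]
  · have hi3 := hne i hi
    by_cases hl : i - 1 = j
    · have hr : i + 1 ≠ j := by
        intro hr
        apply htwo
        linear_combination hr - hl
      simp [step, hi3, hne _ hr]
    · simp [step, hi3, hne _ hl]

theorem candy_eventually_fixed (n : ℕ) [NeZero n] (hn : 2 < n)
    (c : ZMod n → ℕ) (hc : 3 * n - 2 ≤ ∑ i, c i) :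
    ∃ T : ℕ, step (step^[T] c) = step^[T] c := by
  by_cases h : ∃ i, ∀ t, 3 < step^[t] c i
  · obtain ⟨i, hi⟩ := h
    exact exists_fixed_of_eventually_two_le (i := i) ⟨0, fun t _ => by have := hi t; omega⟩
  · push Not at h
    choose T hT using h
    refine ⟨Finset.univ.sup T + 1, ?_⟩
    rw [Function.iterate_succ_apply']
    exact step_step_step_eq hn (by rwa [sum_iterate_step]) fun i =>
      iterate_step_le_three (Finset.le_sup (Finset.mem_univ i)) (hT i)
end

section
/- For every n > 2 and every initial configuration c : ZMod n → ℕ, there exists a natural number T such that for all t ≥ T the set of students with abundant piles is fixed and the piles of all such students have stabilized; that is, {i : (step^[t] c) i ≥ 4} = {i : (step^[T] c) i ≥ 4}, and for every student i with (step^[T] c) i ≥ 4 one has (step^[t] c) i = (step^[T] c) i. -/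
/-- Truncating piles from below at `3` turns `step` into a non-increasing operation. -/
theorem max_step_le {n : ℕ} (c : ZMod n → ℕ) (i : ZMod n) :
    max (step c i) 3 ≤ max (c i) 3 := by
  unfold step
  split_ifs <;> omega

theorem antitone_max_step_iterate {n : ℕ} (c : ZMod n → ℕ) (i : ZMod n) :
    Antitone fun t : ℕ => max ((step^[t] c) i) 3 :=
  antitone_nat_of_succ_le fun t => by
    simpa only [Function.iterate_succ_apply'] using max_step_le (step^[t] c) i

/-- An antitone sequence of natural numbers is eventually constant. -/
theorem Antitone.exists_forall_ge_eq {f : ℕ → ℕ} (hf : Antitone f) :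
    ∃ T, ∀ t ≥ T, f t = f T := by
  obtain ⟨_, ⟨T, rfl⟩, hmin⟩ := exists_minimal_of_wellFoundedLT (· ∈ Set.range f) ⟨f 0, 0, rfl⟩
  exact ⟨T, fun t ht => le_antisymm (hf ht) (hmin ⟨t, rfl⟩ (hf ht))⟩

theorem abundant_set_and_piles_stabilize (n : ℕ) (hn : 2 < n) (c : ZMod n → ℕ) :
    ∃ T : ℕ, ∀ t ≥ T,
      ({i : ZMod n | 4 ≤ (step^[t] c) i} = {i : ZMod n | 4 ≤ (step^[T] c) i}) ∧
      (∀ i : ZMod n, 4 ≤ (step^[T] c) i → (step^[t] c) i = (step^[T] c) i) := by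
  have : NeZero n := ⟨by omega⟩
  choose T hT using fun i => (antitone_max_step_iterate c i).exists_forall_ge_eq
  refine ⟨Finset.univ.sup T, fun t ht => ?_⟩
  have key (i : ZMod n) :
      max ((step^[t] c) i) 3 = max ((step^[Finset.univ.sup T] c) i) 3 := by
    have hi : T i ≤ Finset.univ.sup T := Finset.le_sup (Finset.mem_univ i)
    exact (hT i t (hi.trans ht)).trans (hT i _ hi).symm
  refine ⟨?_, fun i hi => ?_⟩
  · ext i
    have := key i
    simp only [Set.mem_ofPred_eq]
    omega
  · have := key i
    omega
end

section
/- For every n > 2 and every configuration c : ZMod n → ℕ, the total amount of candy possessed by students with abundant candy piles is nonincreasing under one round of candy-passing: ∑_{i : (step c) i ≥ 4} (step c) i ≤ ∑_{i : c i ≥ 4} c i. -/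
/-- A student with at least four candies after a round had at least as many before it. -/
theorem step_le_of_four_le_step {n : ℕ} (c : ZMod n → ℕ) {i : ZMod n} (h : 4 ≤ step c i) :
    step c i ≤ c i := by
  unfold step at *
  split_ifs at * <;> omega

theorem abundant_total_nonincreasing (n : ℕ) [NeZero n] (hn : 2 < n) (c : ZMod n → ℕ) :
    ∑ i ∈ Finset.univ.filter (fun i : ZMod n => 4 ≤ step c i), step c i ≤
      ∑ i ∈ Finset.univ.filter (fun i : ZMod n => 4 ≤ c i), c i := by
  have hle : ∀ i, 4 ≤ step c i → step c i ≤ c i := fun _ => step_le_of_four_le_step c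
  calc
    _ ≤ ∑ i ∈ Finset.univ.filter (fun i : ZMod n => 4 ≤ step c i), c i :=
      Finset.sum_le_sum fun i hi => hle i (Finset.mem_filter.mp hi).2
    _ ≤ _ := Finset.sum_le_sum_of_subset
      (Finset.monotone_filter_right _ fun i _ hi => hi.trans (hle i hi))
end

section
/- For every n > 2 and every configuration c : ZMod n → ℕ, if some student with an abundant candy pile loses candy during a round, i.e. there exists i with c i ≥ 4 and (step c) i < c i, then the total amount of candy possessed by students with abundant piles strictly decreases: ∑_{i : (step c) i ≥ 4} (step c) i < ∑_{i : c i ≥ 4} c i. -/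
theorem step_le_of_two_le {n : ℕ} (c : ZMod n → ℕ) {i : ZMod n} (hi : 2 ≤ c i) :
    step c i ≤ c i := by
  unfold step
  split_ifs <;> omega

theorem step_lt_four_of_lt_four {n : ℕ} (c : ZMod n → ℕ) {i : ZMod n} (hi : c i < 4) :
    step c i < 4 := by
  unfold step
  split_ifs <;> omega

theorem abundant_total_strict_decrease (n : ℕ) [NeZero n] (hn : 2 < n) (c : ZMod n → ℕ)
    (h : ∃ i : ZMod n, 4 ≤ c i ∧ step c i < c i) :
    ∑ i ∈ Finset.univ.filter (fun i : ZMod n => 4 ≤ step c i), step c i <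
      ∑ i ∈ Finset.univ.filter (fun i : ZMod n => 4 ≤ c i), c i := by
  obtain ⟨i, hi, hlt⟩ := h
  have hsub : Finset.univ.filter (fun j : ZMod n => 4 ≤ step c j) ⊆
      Finset.univ.filter (fun j : ZMod n => 4 ≤ c j) :=
    Finset.monotone_filter_right _ fun j _ hj =>
      not_lt.mp fun hj' => (step_lt_four_of_lt_four c hj').not_ge hj
  refine (Finset.sum_le_sum_of_subset hsub).trans_lt
    (Finset.sum_lt_sum (fun j hj => ?_) ⟨i, by simpa using hi, hlt⟩)
  have hj : 4 ≤ c j := by simpa using hj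
  exact step_le_of_two_le c (by omega)
end

section
/- For every n > 2 and every initial configuration c : ZMod n → ℕ, the total amount of candy possessed by students with abundant candy piles eventually stops decreasing: there exists a natural number T such that for all t ≥ T, ∑_{i : (step^[t] c) i ≥ 4} (step^[t] c) i = ∑_{i : (step^[T] c) i ≥ 4} (step^[T] c) i. -/
/-- A pile contributes no more to the abundant total after a round than before it. -/
theorem step_abundant_le {n : ℕ} (c : ZMod n → ℕ) (i : ZMod n) :
    (if 4 ≤ step c i then step c i else 0) ≤ if 4 ≤ c i then c i else 0 := by
  unfold step
  split_ifs <;> omega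

/-- The total of the abundant piles never increases during the game. -/
theorem abundant_total_antitone {n : ℕ} [NeZero n] (c : ZMod n → ℕ) :
    Antitone fun t : ℕ =>
      ∑ i ∈ Finset.univ.filter (fun i : ZMod n => 4 ≤ (step^[t] c) i), (step^[t] c) i := by
  refine antitone_nat_of_succ_le fun t => ?_
  simp only [Finset.sum_filter, Function.iterate_succ_apply']
  exact Finset.sum_le_sum fun i _ => step_abundant_le _ i

theorem abundant_total_eventually_constant (n : ℕ) [NeZero n] (hn : 2 < n)
    (c : ZMod n → ℕ) :
    ∃ T : ℕ, ∀ t ≥ T,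
      ∑ i ∈ Finset.univ.filter (fun i : ZMod n => 4 ≤ (step^[t] c) i), (step^[t] c) i =
        ∑ i ∈ Finset.univ.filter (fun i : ZMod n => 4 ≤ (step^[T] c) i), (step^[T] c) i := by
  obtain ⟨T, hT⟩ := WellFoundedLT.antitone_chain_condition (abundant_total_antitone c)
  exact ⟨T, fun t ht => (hT t ht).symm⟩
end
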